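/- There exists L₁ > 0 such that for every fixed L ≥ L₁ there exists δ₀ > 0 with the following property. Let u : [0,3L] × ℝ → ℝ^k be C² and 2π-periodic in θ, and suppose u solves Δu + A_t ∂_t u + A_θ ∂_θ u + B u = h on [0,3L] × ℝ, where A_t, A_θ, B are continuous k×k-matrix-valued functions with sup|A_t| ≤ δ₀, sup|A_θ| ≤ δ₀, sup|B| ≤ δ₀, and h is continuous with (∫_{[0,3L]×[0,2π]} |h|² dt dθ)^{1/2} ≤ δ₀ · max_{1≤i≤3} ‖u‖₁,ᵢ. Then: (a) ‖u‖₁,₃ ≤ e^{-L/2} ‖u‖₁,₂ implies ‖u‖₁,₂ ≤ e^{-L/2} ‖u‖₁,₁; and (b) ‖u‖₁,₁ ≤ e^{-L/2} ‖u‖₁,₂ implies ‖u‖₁,₂ ≤ e^{-L/2} ‖u‖₁,₃. -/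

import Mathlib

open Real MeasureTheory

variable {E : Type*} [NormedAddCommGroup E] [NormedSpace ℝ E]

/-- Partial derivative `∂_t u`. -/
noncomputable def pt (u : ℝ × ℝ → E) (p : ℝ × ℝ) : E := fderiv ℝ u p (1, 0)

/-- Partial derivative `∂_θ u`. -/
noncomputable def pθ (u : ℝ × ℝ → E) (p : ℝ × ℝ) : E := fderiv ℝ u p (0, 1)

/-- Flat cylinder Laplacian `Δu = ∂²u/∂t² + ∂²u/∂θ²` (componentwise). -/
noncomputable def cylLap (u : ℝ × ℝ → E) (p : ℝ × ℝ) : E := pt (pt u) p + pθ (pθ u) p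

/-- Squared `W^{1,2}`-norm of `u` over the cylinder piece `[(i-1)L, iL] × [0, 2π]`. -/
noncomputable def normOneSq (L : ℝ) (i : ℕ) (u : ℝ × ℝ → E) : ℝ :=
  ∫ t in (((i : ℝ) - 1) * L)..((i : ℝ) * L), ∫ θ in (0 : ℝ)..(2 * π),
    ‖u (t, θ)‖ ^ 2 + ‖pt u (t, θ)‖ ^ 2 + ‖pθ u (t, θ)‖ ^ 2

/-- The `W^{1,2}`-norm `‖u‖₁,ᵢ`. -/
noncomputable def normOne (L : ℝ) (i : ℕ) (u : ℝ × ℝ → E) : ℝ :=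
  Real.sqrt (normOneSq L i u)


theorem intervalIntegral_swap_of_continuous {V : Type*} [NormedAddCommGroup V] [NormedSpace ℝ V]
    {F : ℝ × ℝ → V} (hF : Continuous F) (a b c d : ℝ) :
    ∫ t in a..b, ∫ θ in c..d, F (t, θ) = ∫ θ in c..d, ∫ t in a..b, F (t, θ) := by
  refine intervalIntegral_intervalIntegral_swap (F := fun t θ => F (t, θ)) ?_
  exact (hF.continuousOn.integrableOn_compact (isCompact_uIcc.prod isCompact_uIcc)).mono_set
    (Set.prod_mono Set.uIoc_subset_uIcc Set.uIoc_subset_uIcc)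

theorem sq_intervalIntegral_le {g : ℝ → ℝ} (hg : Continuous g) {a b : ℝ} (hab : a ≤ b) :
    (∫ x in a..b, g x) ^ 2 ≤ (b - a) * ∫ x in a..b, g x ^ 2 := by
  rcases hab.eq_or_lt with rfl | hlt
  · simp
  set I := ∫ x in a..b, g x with hI
  set c := I / (b - a) with hc
  have h0 : 0 ≤ ∫ x in a..b, (g x - c) ^ 2 :=
    intervalIntegral.integral_nonneg hab fun x _ => sq_nonneg _
  have h1 : ∫ x in a..b, (g x - c) ^ 2
      = (∫ x in a..b, g x ^ 2) - 2 * c * I + c ^ 2 * (b - a) := by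
    have : ∀ x, (g x - c) ^ 2 = g x ^ 2 - 2 * c * g x + c ^ 2 := fun x => by ring
    simp_rw [this]
    rw [intervalIntegral.integral_add, intervalIntegral.integral_sub,
      intervalIntegral.integral_const_mul, intervalIntegral.integral_const, smul_eq_mul, ← hI]
    · ring
    all_goals exact Continuous.intervalIntegrable (by fun_prop) _ _
  have hb : 0 < b - a := by linarith
  have h2 : I = c * (b - a) := by rw [hc]; field_simp
  rw [h1] at h0
  rw [h2] at h0 ⊢
  nlinarith

theorem sq_norm_intervalIntegral_le {V : Type*} [NormedAddCommGroup V] [NormedSpace ℝ V]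
    {v : ℝ → V} (hv : Continuous v) {a b : ℝ} (hab : a ≤ b) :
    ‖∫ x in a..b, v x‖ ^ 2 ≤ (b - a) * ∫ x in a..b, ‖v x‖ ^ 2 :=
  (pow_le_pow_left₀ (norm_nonneg _) (intervalIntegral.norm_integral_le_integral_norm hab) 2).trans
    (sq_intervalIntegral_le hv.norm hab)

theorem wirtinger_real {f f' : ℝ → ℝ} (hf' : Continuous f')
    (hd : ∀ x, HasDerivAt f (f' x) x) (hper : f (2 * π) = f 0) :
    ∫ x in (0 : ℝ)..(2 * π), f x ^ 2 ≤
      (∫ x in (0 : ℝ)..(2 * π), f' x ^ 2) + (2 * π)⁻¹ * (∫ x in (0 : ℝ)..(2 * π), f x) ^ 2 := by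
  have hf : Continuous f := continuous_iff_continuousAt.2 fun x => (hd x).continuousAt
  have hpi : (0 : ℝ) < 2 * π := by positivity
  let g : ℝ → ℂ := fun x => f x
  let g' : ℝ → ℂ := fun x => f' x
  have hg : Continuous g := by fun_prop
  have hg' : Continuous g' := by fun_prop
  have mem : ∀ G : ℝ → ℂ, Continuous G → MemLp G 2 (volume.restrict (Set.Ioc 0 (2 * π))) := by
    intro G hG
    have : MemLp G 2 (volume.restrict (Set.Icc 0 (2 * π))) := by
      rw [memLp_two_iff_integrable_sq_norm hG.aestronglyMeasurable]
      exact (hG.norm.pow 2).integrableOn_Icc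
    exact this.mono_measure (Measure.restrict_mono Set.Ioc_subset_Icc_self le_rfl)
  have s1 := hasSum_sq_fourierCoeffOn hpi (mem g hg)
  have s2 := hasSum_sq_fourierCoeffOn hpi (mem g' hg')
  have s0 : HasSum (fun n : ℤ => if n = 0 then ‖fourierCoeffOn hpi g 0‖ ^ 2 else 0)
      (‖fourierCoeffOn hpi g 0‖ ^ 2) := hasSum_ite_eq 0 _
  have hle := hasSum_le (fun n => ?_) s1 (s2.add s0)
  · have e0 : ‖fourierCoeffOn hpi g 0‖ = (2 * π)⁻¹ * |∫ x in (0 : ℝ)..(2 * π), f x| := by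
      rw [fourierCoeffOn_eq_integral]
      simp only [neg_zero, fourier_zero, one_smul, g]
      rw [intervalIntegral.integral_ofReal, norm_smul]
      simp [abs_of_pos pi_pos]
    have n1 : ∀ x, ‖g x‖ ^ 2 = f x ^ 2 := fun x => by simp [g]
    have n2 : ∀ x, ‖g' x‖ ^ 2 = f' x ^ 2 := fun x => by simp [g']
    simp only [n1, n2, e0, sub_zero, smul_eq_mul, mul_pow, sq_abs] at hle
    have := mul_le_mul_of_nonneg_left hle hpi.le
    field_simp at this ⊢
    linarith
  · by_cases hn : n = 0
    · subst hn
      simp only [if_true]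
      nlinarith [sq_nonneg ‖fourierCoeffOn hpi g' 0‖]
    · simp only [hn, if_false, add_zero]
      rw [fourierCoeffOn_of_hasDerivAt hpi hn (fun x _ => (hd x).ofReal_comp)
        (hg'.intervalIntegrable _ _)]
      have : ((f (2 * π) : ℂ)) - (f 0 : ℂ) = 0 := by rw [hper, sub_self]
      rw [this, mul_zero, zero_sub]
      have hn1 : (1 : ℝ) ≤ |(n : ℝ)| := by
        exact_mod_cast Int.one_le_abs hn
      have : ‖(1 / (-2 * π * Complex.I * n) : ℂ) *
          -((((2 * π : ℝ) : ℂ) - ((0 : ℝ) : ℂ)) * fourierCoeffOn hpi g' n)‖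
          = |(n : ℝ)|⁻¹ * ‖fourierCoeffOn hpi g' n‖ := by
        simp [abs_of_pos pi_pos]
        field_simp
      rw [this]
      have h3 : |(n : ℝ)|⁻¹ ≤ 1 := inv_le_one_of_one_le₀ hn1
      exact pow_le_pow_left₀ (by positivity)
        (mul_le_of_le_one_left (norm_nonneg _) h3) 2

theorem wirtinger_euclidean {k : ℕ} {f f' : ℝ → EuclideanSpace ℝ (Fin k)} (hf' : Continuous f')
    (hd : ∀ x, HasDerivAt f (f' x) x) (hper : f (2 * π) = f 0) :
    ∫ x in (0 : ℝ)..(2 * π), ‖f x‖ ^ 2 ≤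
      (∫ x in (0 : ℝ)..(2 * π), ‖f' x‖ ^ 2) +
        (2 * π)⁻¹ * ‖∫ x in (0 : ℝ)..(2 * π), f x‖ ^ 2 := by
  have hf : Continuous f := continuous_iff_continuousAt.2 fun x => (hd x).continuousAt
  have hc : ∀ v : ℝ → EuclideanSpace ℝ (Fin k), Continuous v → ∀ i, Continuous fun x => v x i :=
    fun v hv i => (EuclideanSpace.proj (𝕜 := ℝ) i).continuous.comp hv
  have hcomp : ∀ v : ℝ → EuclideanSpace ℝ (Fin k), Continuous v →
      ∫ x in (0 : ℝ)..(2 * π), ‖v x‖ ^ 2 = ∑ i, ∫ x in (0 : ℝ)..(2 * π), v x i ^ 2 := by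
    intro v hv
    rw [← intervalIntegral.integral_finsetSum (f := fun i x => v x i ^ 2)
      fun i _ => ((hc v hv i).pow 2).intervalIntegrable _ _]
    simp_rw [EuclideanSpace.real_norm_sq_eq]
  have hint : ∀ i, (∫ x in (0 : ℝ)..(2 * π), f x) i = ∫ x in (0 : ℝ)..(2 * π), f x i := fun i =>
    ((EuclideanSpace.proj (𝕜 := ℝ) i).intervalIntegral_comp_comm
      (hf.intervalIntegrable 0 (2 * π))).symm
  rw [hcomp f hf, hcomp f' hf', EuclideanSpace.real_norm_sq_eq, Finset.mul_sum,
    ← Finset.sum_add_distrib]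
  refine Finset.sum_le_sum fun i _ => ?_
  rw [hint]
  exact wirtinger_real (hc f' hf' i)
    (fun x => (EuclideanSpace.proj (𝕜 := ℝ) i).hasFDerivAt.comp_hasDerivAt x (hd x))
    (congrArg (fun v => v i) hper)

theorem integral_expRem_mul_second_deriv_le {T b : ℝ} (hT : 0 ≤ T) (hb : 0 ≤ b)
    {G G₁ G₂ : ℝ → ℝ} (hG : Continuous G) (hG₁ : Continuous G₁) (hG₂ : Continuous G₂)
    (d₁ : ∀ t ∈ Set.Ioo 0 T, HasDerivAt G (G₁ t) t)
    (d₂ : ∀ t ∈ Set.Ioo 0 T, HasDerivAt G₁ (G₂ t) t) (hpos : 0 ≤ G (T / 2)) :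
    ∫ t in (0 : ℝ)..T, (exp (b * min t (T - t)) - 1 - b * min t (T - t)) * G₂ t ≤
      ∫ t in (0 : ℝ)..T, b ^ 2 * exp (b * min t (T - t)) * G t := by
  rw [← sub_nonpos, ← intervalIntegral.integral_sub
    (Continuous.intervalIntegrable (by fun_prop) _ _)
    (Continuous.intervalIntegrable (by fun_prop) _ _),
    ← intervalIntegral.integral_add_adjacent_intervals (b := T / 2)
    (Continuous.intervalIntegrable (by fun_prop) _ _)
    (Continuous.intervalIntegrable (by fun_prop) _ _)]
  have left : ∫ t in (0 : ℝ)..(T / 2), ((exp (b * min t (T - t)) - 1 - b * min t (T - t)) * G₂ t -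
      b ^ 2 * exp (b * min t (T - t)) * G t) =
      (exp (b * (T / 2)) - 1 - b * (T / 2)) * G₁ (T / 2) -
        b * (exp (b * (T / 2)) - 1) * G (T / 2) := by
    rw [intervalIntegral.integral_congr (g := fun t => (exp (b * t) - 1 - b * t) * G₂ t -
      b ^ 2 * exp (b * t) * G t)]
    · rw [intervalIntegral.integral_eq_sub_of_hasDerivAt_of_le
        (f := fun t => (exp (b * t) - 1 - b * t) * G₁ t - b * (exp (b * t) - 1) * G t)
        (by linarith) (by fun_prop) _ (Continuous.intervalIntegrable (by fun_prop) _ _)]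
      · simp
      · intro x hx
        have hx' : x ∈ Set.Ioo 0 T := ⟨hx.1, by linarith [hx.2, hx.1]⟩
        have he : HasDerivAt (fun t => exp (b * t)) (exp (b * x) * (b * 1)) x :=
          ((hasDerivAt_id x).const_mul b).exp
        have hl : HasDerivAt (fun t => b * t) (b * 1) x := (hasDerivAt_id x).const_mul b
        refine HasDerivAt.congr_deriv ((((he.sub_const 1).sub hl).mul (d₂ x hx')).sub
          (((he.sub_const 1).const_mul b).mul (d₁ x hx'))) ?_
        simp only [Pi.sub_apply]
        ring
    · intro t ht
      rw [Set.uIcc_of_le (by linarith)] at ht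
      simp only [min_eq_left (show t ≤ T - t by linarith [ht.2])]
  have right : ∫ t in (T / 2)..T, ((exp (b * min t (T - t)) - 1 - b * min t (T - t)) * G₂ t -
      b ^ 2 * exp (b * min t (T - t)) * G t) =
      -((exp (b * (T / 2)) - 1 - b * (T / 2)) * G₁ (T / 2)) -
        b * (exp (b * (T / 2)) - 1) * G (T / 2) := by
    rw [intervalIntegral.integral_congr (g := fun t =>
      (exp (b * (T - t)) - 1 - b * (T - t)) * G₂ t - b ^ 2 * exp (b * (T - t)) * G t)]
    · rw [intervalIntegral.integral_eq_sub_of_hasDerivAt_of_le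
        (f := fun t => (exp (b * (T - t)) - 1 - b * (T - t)) * G₁ t +
          b * (exp (b * (T - t)) - 1) * G t)
        (by linarith) (by fun_prop) _ (Continuous.intervalIntegrable (by fun_prop) _ _)]
      · simp only [sub_self, mul_zero, exp_zero, zero_mul, add_zero,
          show T - T / 2 = T / 2 by ring]
        ring
      · intro x hx
        have hx' : x ∈ Set.Ioo 0 T := ⟨by linarith [hx.1, hx.2], hx.2⟩
        have hl : HasDerivAt (fun t => b * (T - t)) (b * -1) x :=
          ((hasDerivAt_id x).const_sub T).const_mul b
        have he : HasDerivAt (fun t => exp (b * (T - t))) (exp (b * (T - x)) * (b * -1)) x :=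
          hl.exp
        refine HasDerivAt.congr_deriv ((((he.sub_const 1).sub hl).mul (d₂ x hx')).add
          (((he.sub_const 1).const_mul b).mul (d₁ x hx'))) ?_
        simp only [Pi.sub_apply]
        ring
    · intro t ht
      rw [Set.uIcc_of_le (by linarith)] at ht
      simp only [min_eq_right (show T - t ≤ t by linarith [ht.1])]
  rw [left, right]
  have : 0 ≤ b * (exp (b * (T / 2)) - 1) * G (T / 2) := by
    have := one_le_exp (show 0 ≤ b * (T / 2) by positivity)
    exact mul_nonneg (mul_nonneg hb (by linarith)) hpos
  linarith

/-- Iterated integral over the cylinder piece `[a, b] × [0, 2π]`. -/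
noncomputable def cylInt (a b : ℝ) (F : ℝ × ℝ → ℝ) : ℝ :=
  ∫ t in a..b, ∫ θ in (0 : ℝ)..(2 * π), F (t, θ)

theorem continuous_circleInt {V : Type*} [NormedAddCommGroup V] [NormedSpace ℝ V]
    {F : ℝ × ℝ → V} (hF : Continuous F) :
    Continuous fun t => ∫ θ in (0 : ℝ)..(2 * π), F (t, θ) :=
  intervalIntegral.continuous_parametric_intervalIntegral_of_continuous'
    (f := fun t θ => F (t, θ)) hF _ _

theorem cylInt_add {F G : ℝ × ℝ → ℝ} (hF : Continuous F) (hG : Continuous G) (a b : ℝ) :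
    cylInt a b (fun p => F p + G p) = cylInt a b F + cylInt a b G := by
  unfold cylInt
  rw [← intervalIntegral.integral_add ((continuous_circleInt hF).intervalIntegrable _ _)
    ((continuous_circleInt hG).intervalIntegrable _ _)]
  congr 1
  ext t
  exact intervalIntegral.integral_add (Continuous.intervalIntegrable (by fun_prop) _ _)
    (Continuous.intervalIntegrable (by fun_prop) _ _)

theorem cylInt_const_mul (c : ℝ) (F : ℝ × ℝ → ℝ) (a b : ℝ) :
    cylInt a b (fun p => c * F p) = c * cylInt a b F := by
  simp [cylInt]

theorem cylInt_mono {F G : ℝ × ℝ → ℝ} (hF : Continuous F) (hG : Continuous G) {a b : ℝ}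
    (hab : a ≤ b) (h : ∀ t ∈ Set.Ioo a b, ∀ θ, F (t, θ) ≤ G (t, θ)) :
    cylInt a b F ≤ cylInt a b G := by
  refine intervalIntegral.integral_mono_on_of_le_Ioo hab
    ((continuous_circleInt hF).intervalIntegrable _ _)
    ((continuous_circleInt hG).intervalIntegrable _ _) fun t ht => ?_
  exact intervalIntegral.integral_mono_on (by positivity)
    (Continuous.intervalIntegrable (by fun_prop) _ _)
    (Continuous.intervalIntegrable (by fun_prop) _ _) fun θ _ => h t ht θ

theorem cylInt_nonneg {F : ℝ × ℝ → ℝ} {a b : ℝ} (hab : a ≤ b) (h : ∀ p, 0 ≤ F p) :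
    0 ≤ cylInt a b F :=
  intervalIntegral.integral_nonneg hab fun _ _ =>
    intervalIntegral.integral_nonneg (by positivity) fun _ _ => h _

theorem cylInt_add_adjacent {F : ℝ × ℝ → ℝ} (hF : Continuous F) (a b c : ℝ) :
    cylInt a b F + cylInt b c F = cylInt a c F :=
  intervalIntegral.integral_add_adjacent_intervals
    ((continuous_circleInt hF).intervalIntegrable _ _)
    ((continuous_circleInt hF).intervalIntegrable _ _)

theorem cylInt_congr {F G : ℝ × ℝ → ℝ} {a b : ℝ} (hab : a ≤ b)
    (h : ∀ t ∈ Set.Ioo a b, ∀ θ, F (t, θ) = G (t, θ)) : cylInt a b F = cylInt a b G := by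
  refine intervalIntegral.integral_congr_Ioo_of_le hab fun t ht => ?_
  simp only [h t ht]

theorem sq_norm_add₃_le {V : Type*} [SeminormedAddCommGroup V] (x y z : V) :
    ‖x + y + z‖ ^ 2 ≤ 3 * (‖x‖ ^ 2 + ‖y‖ ^ 2 + ‖z‖ ^ 2) := by
  have := pow_le_pow_left₀ (norm_nonneg _) (norm_add₃_le (a := x) (b := y) (c := z)) 2
  linarith [sq_nonneg (‖x‖ - ‖y‖), sq_nonneg (‖x‖ - ‖z‖), sq_nonneg (‖y‖ - ‖z‖)]

/-- `u` and its derivatives up to second order on the open strip `(0, T) × ℝ`, for `u` of class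
`C²` up to the boundary and `2π`-periodic in the second variable; the values outside the strip
are those of some continuous extension. -/
structure IsStripJet {V : Type*} [NormedAddCommGroup V] [NormedSpace ℝ V] (T : ℝ)
    (u ut uθ utt uθθ : ℝ × ℝ → V) : Prop where
  cont : Continuous u
  cont_t : Continuous ut
  cont_θ : Continuous uθ
  cont_tt : Continuous utt
  cont_θθ : Continuous uθθ
  deriv_t : ∀ t ∈ Set.Ioo 0 T, ∀ θ, HasDerivAt (fun s => u (s, θ)) (ut (t, θ)) t
  deriv_tt : ∀ t ∈ Set.Ioo 0 T, ∀ θ, HasDerivAt (fun s => ut (s, θ)) (utt (t, θ)) t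
  deriv_θ : ∀ t ∈ Set.Ioo 0 T, ∀ θ, HasDerivAt (fun x => u (t, x)) (uθ (t, θ)) θ
  deriv_θθ : ∀ t ∈ Set.Ioo 0 T, ∀ θ, HasDerivAt (fun x => uθ (t, x)) (uθθ (t, θ)) θ
  periodic : ∀ t ∈ Set.Ioo 0 T, u (t, 2 * π) = u (t, 0)
  periodic_θ : ∀ t ∈ Set.Ioo 0 T, uθ (t, 2 * π) = uθ (t, 0)

/-- The integrand of the squared `W^{1,2}`-norm. -/
def energyDensity {V : Type*} [NormedAddCommGroup V] (u ut uθ : ℝ × ℝ → V) (p : ℝ × ℝ) : ℝ :=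
  ‖u p‖ ^ 2 + ‖ut p‖ ^ 2 + ‖uθ p‖ ^ 2

namespace IsStripJet

variable {V : Type*} [NormedAddCommGroup V] [InnerProductSpace ℝ V]
  {T : ℝ} {u ut uθ utt uθθ : ℝ × ℝ → V}

theorem continuous_energyDensity (J : IsStripJet T u ut uθ utt uθθ) :
    Continuous (energyDensity u ut uθ) := by
  have := J.cont
  have := J.cont_t
  have := J.cont_θ
  unfold energyDensity
  fun_prop

theorem circleInt_taylor [CompleteSpace V] (J : IsStripJet T u ut uθ utt uθθ) {t r : ℝ}
    (ht : t ∈ Set.Icc 0 T) (hr : r ∈ Set.Icc 0 T) :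
    ∫ θ in (0 : ℝ)..(2 * π), u (t, θ) = (∫ θ in (0 : ℝ)..(2 * π), u (r, θ)) +
      (t - r) • (∫ θ in (0 : ℝ)..(2 * π), ut (r, θ)) +
      ∫ τ in r..t, (t - τ) • ∫ θ in (0 : ℝ)..(2 * π), (utt (τ, θ) + uθθ (τ, θ)) := by
  have c0 := J.cont
  have c1 := J.cont_t
  have c2 := J.cont_tt
  have c3 := J.cont_θθ
  have hsub : ∀ τ ∈ Set.Ioo (min r t) (max r t), τ ∈ Set.Ioo 0 T := fun τ hτ =>
    ⟨(le_min hr.1 ht.1).trans_lt hτ.1, hτ.2.trans_le (max_le hr.2 ht.2)⟩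
  have line : ∀ θ, u (t, θ) = u (r, θ) + (t - r) • ut (r, θ) +
      ∫ τ in r..t, (t - τ) • utt (τ, θ) := by
    intro θ
    rw [intervalIntegral.integral_eq_sub_of_hasDeriv_right
      (f := fun τ => u (τ, θ) + (t - τ) • ut (τ, θ)) (by fun_prop) _
      (Continuous.intervalIntegrable (by fun_prop) _ _)]
    · simp
    · intro τ hτ
      have hl : HasDerivAt (fun τ : ℝ => t - τ) (-1) τ := (hasDerivAt_id τ).const_sub t
      refine (HasDerivAt.congr_deriv ((J.deriv_t τ (hsub τ hτ) θ).add
        (hl.smul (J.deriv_tt τ (hsub τ hτ) θ))) ?_).hasDerivWithinAt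
      simp
  have hθθ : ∀ τ ∈ Set.Ioo 0 T, ∫ θ in (0 : ℝ)..(2 * π), uθθ (τ, θ) = 0 := by
    intro τ hτ
    rw [intervalIntegral.integral_eq_sub_of_hasDerivAt (fun θ _ => J.deriv_θθ τ hτ θ)
      (Continuous.intervalIntegrable (by fun_prop) _ _), J.periodic_θ τ hτ, sub_self]
  have hrem : ∫ τ in r..t, (t - τ) • ∫ θ in (0 : ℝ)..(2 * π), (utt (τ, θ) + uθθ (τ, θ)) =
      ∫ θ in (0 : ℝ)..(2 * π), ∫ τ in r..t, (t - τ) • utt (τ, θ) := by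
    rw [← intervalIntegral_swap_of_continuous (F := fun p => (t - p.1) • utt p) (by fun_prop)]
    refine intervalIntegral.integral_congr_uIoo fun τ hτ => ?_
    simp only
    rw [intervalIntegral.integral_add (Continuous.intervalIntegrable (by fun_prop) _ _)
      (Continuous.intervalIntegrable (by fun_prop) _ _), hθθ τ (hsub τ hτ), add_zero,
      intervalIntegral.integral_smul]
  have c4 : Continuous fun θ => ∫ τ in r..t, (t - τ) • utt (τ, θ) := by
    refine intervalIntegral.continuous_parametric_intervalIntegral_of_continuous'
      (f := fun θ τ => (t - τ) • utt (τ, θ)) ?_ _ _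
    fun_prop
  rw [hrem, intervalIntegral.integral_congr (fun θ _ => line θ), intervalIntegral.integral_add,
    intervalIntegral.integral_add, intervalIntegral.integral_smul]
  all_goals exact Continuous.intervalIntegrable (by fun_prop) _ _

theorem sq_norm_circleInt_le [CompleteSpace V] (J : IsStripJet T u ut uθ utt uθθ) {t r : ℝ}
    (ht : t ∈ Set.Icc 0 T) (hr : r ∈ Set.Icc 0 T) :
    (2 * π)⁻¹ * ‖∫ θ in (0 : ℝ)..(2 * π), u (t, θ)‖ ^ 2 ≤
      3 * (1 + T ^ 2) * (∫ θ in (0 : ℝ)..(2 * π), energyDensity u ut uθ (r, θ)) +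
      3 * T ^ 3 * cylInt 0 T (fun p => ‖utt p + uθθ p‖ ^ 2) := by
  have c0 := J.cont
  have c1 := J.cont_t
  have c5 := J.cont_θ
  have c2 := J.cont_tt
  have c3 := J.cont_θθ
  have hT : 0 ≤ T := ht.1.trans ht.2
  have hpi : (0 : ℝ) < 2 * π := by positivity
  set f : ℝ × ℝ → V := fun p => utt p + uθθ p
  have cf : Continuous f := by fun_prop
  set m : ℝ → V := fun τ => ∫ θ in (0 : ℝ)..(2 * π), f (τ, θ) with hm
  have cm : Continuous m := continuous_circleInt cf
  set F := cylInt 0 T (fun p => ‖f p‖ ^ 2) with hF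
  have key := J.circleInt_taylor ht hr
  set A := ∫ θ in (0 : ℝ)..(2 * π), u (r, θ) with hA
  set B := ∫ θ in (0 : ℝ)..(2 * π), ut (r, θ) with hB
  set R := ∫ τ in r..t, (t - τ) • m τ with hR
  have key' : ∫ θ in (0 : ℝ)..(2 * π), u (t, θ) = A + (t - r) • B + R := key
  have e1 : ‖A‖ ^ 2 ≤ 2 * π * ∫ θ in (0 : ℝ)..(2 * π), ‖u (r, θ)‖ ^ 2 := by
    simpa using sq_norm_intervalIntegral_le (v := fun θ => u (r, θ)) (by fun_prop) hpi.le
  have e2 : ‖B‖ ^ 2 ≤ 2 * π * ∫ θ in (0 : ℝ)..(2 * π), ‖ut (r, θ)‖ ^ 2 := by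
    simpa using sq_norm_intervalIntegral_le (v := fun θ => ut (r, θ)) (by fun_prop) hpi.le
  have htr : |t - r| ≤ T := abs_le.2 ⟨by linarith [ht.1, hr.2], by linarith [ht.2, hr.1]⟩
  have e3 : ‖R‖ ≤ T * ∫ τ in (0 : ℝ)..T, ‖m τ‖ := by
    rw [← intervalIntegral.integral_const_mul, intervalIntegral.integral_of_le hT]
    refine intervalIntegral.norm_integral_le_integral_norm_uIoc.trans ?_
    have hsub : Set.uIoc r t ⊆ Set.Ioc 0 T := fun x hx =>
      ⟨(le_min hr.1 ht.1).trans_lt hx.1, hx.2.trans (max_le hr.2 ht.2)⟩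
    have i1 : IntegrableOn (fun τ => T * ‖m τ‖) (Set.Ioc 0 T) :=
      (show Continuous fun τ => T * ‖m τ‖ by fun_prop).integrableOn_Ioc
    refine (setIntegral_mono_on ((show Continuous fun τ => ‖(t - τ) • m τ‖ by
      fun_prop).integrableOn_uIoc) (i1.mono_set hsub) measurableSet_uIoc fun τ hτ => ?_).trans
      (setIntegral_mono_set i1 (Filter.Eventually.of_forall fun τ => by positivity)
        hsub.eventuallyLE)
    rw [norm_smul]
    refine mul_le_mul_of_nonneg_right ?_ (norm_nonneg _)
    have := hsub hτ
    exact abs_le.2 ⟨by linarith [ht.1, this.2], by linarith [ht.2, this.1]⟩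
  have e4 : (∫ τ in (0 : ℝ)..T, ‖m τ‖) ^ 2 ≤ T * (2 * π * F) := by
    refine (sq_intervalIntegral_le cm.norm hT).trans ?_
    rw [sub_zero]
    refine mul_le_mul_of_nonneg_left ?_ hT
    rw [hF, cylInt, ← intervalIntegral.integral_const_mul]
    refine intervalIntegral.integral_mono_on hT (Continuous.intervalIntegrable (by fun_prop) _ _)
      (((continuous_circleInt (F := fun p => ‖f p‖ ^ 2) (by fun_prop)).const_mul _).intervalIntegrable _ _) fun τ _ => ?_
    simpa using sq_norm_intervalIntegral_le (v := fun θ => f (τ, θ)) (by fun_prop) hpi.le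
  have e5 : ‖R‖ ^ 2 ≤ T ^ 3 * (2 * π * F) := by
    calc ‖R‖ ^ 2 ≤ (T * ∫ τ in (0 : ℝ)..T, ‖m τ‖) ^ 2 := pow_le_pow_left₀ (norm_nonneg _) e3 2
      _ = T ^ 2 * (∫ τ in (0 : ℝ)..T, ‖m τ‖) ^ 2 := by ring
      _ ≤ T ^ 2 * (T * (2 * π * F)) := mul_le_mul_of_nonneg_left e4 (by positivity)
      _ = _ := by ring
  set a := ∫ θ in (0 : ℝ)..(2 * π), ‖u (r, θ)‖ ^ 2 with ha
  set b := ∫ θ in (0 : ℝ)..(2 * π), ‖ut (r, θ)‖ ^ 2 with hb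
  set c := ∫ θ in (0 : ℝ)..(2 * π), ‖uθ (r, θ)‖ ^ 2 with hc
  have ha0 : 0 ≤ a := intervalIntegral.integral_nonneg hpi.le fun _ _ => by positivity
  have hb0 : 0 ≤ b := intervalIntegral.integral_nonneg hpi.le fun _ _ => by positivity
  have hc0 : 0 ≤ c := intervalIntegral.integral_nonneg hpi.le fun _ _ => by positivity
  have hE : ∫ θ in (0 : ℝ)..(2 * π), energyDensity u ut uθ (r, θ) = a + b + c := by
    simp only [energyDensity]
    rw [intervalIntegral.integral_add, intervalIntegral.integral_add]
    all_goals exact Continuous.intervalIntegrable (by fun_prop) _ _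
  have e6 : ‖(t - r) • B‖ ^ 2 ≤ T ^ 2 * (2 * π * b) := by
    rw [norm_smul, mul_pow, norm_eq_abs]
    exact mul_le_mul (pow_le_pow_left₀ (abs_nonneg _) htr 2) e2 (by positivity) (by positivity)
  have e7 := sq_norm_add₃_le A ((t - r) • B) R
  rw [key', hE, inv_mul_le_iff₀ hpi]
  have : 0 ≤ 2 * π * (3 * (T ^ 2 * a + b + c + T ^ 2 * c)) := by positivity
  linarith

theorem circleInt_inner_add (J : IsStripJet T u ut uθ utt uθθ) {t : ℝ} (ht : t ∈ Set.Ioo 0 T) :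
    ∫ θ in (0 : ℝ)..(2 * π), (inner ℝ (u (t, θ)) (uθθ (t, θ)) + ‖uθ (t, θ)‖ ^ 2) = 0 := by
  have c0 := J.cont
  have c5 := J.cont_θ
  have c3 := J.cont_θθ
  rw [intervalIntegral.integral_eq_sub_of_hasDerivAt
    (f := fun θ => inner ℝ (u (t, θ)) (uθ (t, θ))) (fun θ _ => ?_)
    (Continuous.intervalIntegrable (by fun_prop) _ _), J.periodic t ht, J.periodic_θ t ht, sub_self]
  refine HasDerivAt.congr_deriv ((J.deriv_θ t ht θ).inner ℝ (J.deriv_θθ t ht θ)) ?_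
  rw [real_inner_self_eq_norm_sq]

theorem cylInt_expRem_le (J : IsStripJet T u ut uθ utt uθθ) (hT : 0 ≤ T) {b : ℝ} (hb : 0 ≤ b) :
    cylInt 0 T (fun p => (exp (b * min p.1 (T - p.1)) - 1 - b * min p.1 (T - p.1)) *
      (2 * (‖ut p‖ ^ 2 + inner ℝ (u p) (utt p)))) ≤
    cylInt 0 T (fun p => b ^ 2 * exp (b * min p.1 (T - p.1)) * ‖u p‖ ^ 2) := by
  have c0 := J.cont
  have c1 := J.cont_t
  have c2 := J.cont_tt
  unfold cylInt
  rw [intervalIntegral_swap_of_continuous (F := fun p =>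
    (exp (b * min p.1 (T - p.1)) - 1 - b * min p.1 (T - p.1)) *
      (2 * (‖ut p‖ ^ 2 + inner ℝ (u p) (utt p)))) (by fun_prop),
    intervalIntegral_swap_of_continuous (F := fun p =>
      b ^ 2 * exp (b * min p.1 (T - p.1)) * ‖u p‖ ^ 2) (by fun_prop)]
  refine intervalIntegral.integral_mono_on (by positivity)
    ((intervalIntegral.continuous_parametric_intervalIntegral_of_continuous' (f := fun θ t => (exp
      (b * min t (T - t)) - 1 - b * min t (T - t)) * (2 * (‖ut (t, θ)‖ ^ 2 + inner ℝ (u (t, θ))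
      (utt (t, θ))))) (by fun_prop) _ _).intervalIntegrable _ _)
    ((intervalIntegral.continuous_parametric_intervalIntegral_of_continuous' (f := fun θ t =>
      b ^ 2 * exp (b * min t (T - t)) * ‖u (t, θ)‖ ^ 2) (by fun_prop) _ _).intervalIntegrable _ _)
    fun θ _ => ?_
  refine integral_expRem_mul_second_deriv_le hT hb (G := fun t => ‖u (t, θ)‖ ^ 2)
    (G₁ := fun t => 2 * inner ℝ (u (t, θ)) (ut (t, θ)))
    (G₂ := fun t => 2 * (‖ut (t, θ)‖ ^ 2 + inner ℝ (u (t, θ)) (utt (t, θ))))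
    (by fun_prop) (by fun_prop) (by fun_prop) (fun t ht => (J.deriv_t t ht θ).norm_sq)
    (fun t ht => ?_) (by positivity)
  refine HasDerivAt.congr_deriv
    (((J.deriv_t t ht θ).inner ℝ (J.deriv_tt t ht θ)).const_mul 2) ?_
  rw [real_inner_self_eq_norm_sq, add_comm]

end IsStripJet

theorem IsStripJet.cylInt_expRem_energy_le {k : ℕ} {T : ℝ}
    {u ut uθ utt uθθ : ℝ × ℝ → EuclideanSpace ℝ (Fin k)}
    (J : IsStripJet T u ut uθ utt uθθ) (hT : 0 ≤ T) {ζ : ℝ} (hζ0 : 0 ≤ ζ)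
    (hζ : ∀ t ∈ Set.Ioo 0 T, (2 * π)⁻¹ * ‖∫ θ in (0 : ℝ)..(2 * π), u (t, θ)‖ ^ 2 ≤ ζ) :
    7 / 50 * cylInt 0 T (fun p => (exp (6 / 5 * min p.1 (T - p.1)) - 1 -
        6 / 5 * min p.1 (T - p.1)) * energyDensity u ut uθ p) ≤
      36 / 25 * (1 + 6 / 5 * T) * cylInt 0 T (energyDensity u ut uθ) +
      43 / 25 * (T * (exp (6 / 5 * (T / 2)) * ζ)) +
      8 * exp (6 / 5 * (T / 2)) * cylInt 0 T (fun p => ‖utt p + uθθ p‖ ^ 2) := by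
  have c0 := J.cont
  have c1 := J.cont_t
  have c5 := J.cont_θ
  have c2 := J.cont_tt
  have c3 := J.cont_θθ
  have ce := J.continuous_energyDensity
  set d : ℝ → ℝ := fun t => min t (T - t) with hd
  set w : ℝ → ℝ := fun t => exp (6 / 5 * d t) - 1 - 6 / 5 * d t with hw
  set M := exp (6 / 5 * (T / 2)) with hM
  have cd : Continuous d := by fun_prop
  have cw : Continuous w := by fun_prop
  have w0 : ∀ t, 0 ≤ w t := fun t => by
    have := add_one_le_exp (6 / 5 * d t)
    simp only [hw]; linarith
  have d0 : ∀ t ∈ Set.Ioo 0 T, 0 ≤ d t := fun t ht => le_min ht.1.le (by linarith [ht.2])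
  have dT : ∀ t, d t ≤ T / 2 := fun t => by
    rcases le_total t (T / 2) with h | h
    · exact (min_le_left _ _).trans h
    · exact (min_le_right _ _).trans (by linarith)
  have wM : ∀ t ∈ Set.Ioo 0 T, w t ≤ M := fun t ht => by
    have h1 : exp (6 / 5 * d t) ≤ M := exp_le_exp.2 (by linarith [dT t])
    simp only [hw]; linarith [d0 t ht]
  have s1 := J.cylInt_expRem_le hT (b := 6 / 5) (by norm_num)
  have s2 : cylInt 0 T (fun p => w p.1 * (inner ℝ (u p) (uθθ p) + ‖uθ p‖ ^ 2)) = 0 := by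
    unfold cylInt
    rw [intervalIntegral.integral_congr_Ioo_of_le (g := fun _ => 0) hT, intervalIntegral.integral_zero]
    intro t ht
    simp only
    rw [intervalIntegral.integral_const_mul, J.circleInt_inner_add ht, mul_zero]
  have s3 : cylInt 0 T (fun p => w p.1 * (‖u p‖ ^ 2 + -1 * ‖uθ p‖ ^ 2)) ≤ T * (M * ζ) := by
    have : T * (M * ζ) = ∫ _ in (0 : ℝ)..T, M * ζ := by simp; ring
    rw [this]
    refine intervalIntegral.integral_mono_on_of_le_Ioo hT
      ((continuous_circleInt (F := fun p => w p.1 * (‖u p‖ ^ 2 + -1 * ‖uθ p‖ ^ 2))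
        (by fun_prop)).intervalIntegrable _ _)
      (by simp) fun t ht => ?_
    simp only
    rw [intervalIntegral.integral_const_mul, intervalIntegral.integral_add
      (Continuous.intervalIntegrable (by fun_prop) _ _)
      (Continuous.intervalIntegrable (by fun_prop) _ _), intervalIntegral.integral_const_mul]
    refine (mul_le_mul_of_nonneg_left (b := ?_) (c := ζ) ?_ (w0 t)).trans
      (mul_le_mul_of_nonneg_right (wM t ht) hζ0)
    have := wirtinger_euclidean (f := fun θ => u (t, θ)) (f' := fun θ => uθ (t, θ))
      (by fun_prop) (J.deriv_θ t ht) (J.periodic t ht)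
    linarith [hζ t ht]
  have s4 : cylInt 0 T (fun p => 7 / 50 * (w p.1 * energyDensity u ut uθ p) +
        ((6 / 5) ^ 2 * exp (6 / 5 * d p.1) * ‖u p‖ ^ 2)) ≤
      cylInt 0 T (fun p => w p.1 * (2 * (‖ut p‖ ^ 2 + inner ℝ (u p) (utt p))) +
        (2 * (w p.1 * (inner ℝ (u p) (uθθ p) + ‖uθ p‖ ^ 2)) +
        (36 / 25 * (1 + 6 / 5 * T) * energyDensity u ut uθ p +
        (43 / 25 * (w p.1 * (‖u p‖ ^ 2 + -1 * ‖uθ p‖ ^ 2)) +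
        8 * M * ‖utt p + uθθ p‖ ^ 2)))) := by
    refine cylInt_mono (by fun_prop) (by fun_prop) hT fun t ht θ => ?_
    simp only [energyDensity]
    have hexp : exp (6 / 5 * d t) = w t + 1 + 6 / 5 * d t := by simp only [hw]; ring
    rw [hexp]
    set x := u (t, θ)
    set a := utt (t, θ)
    set b := uθθ (t, θ)
    have hin : -(7 / 50 * ‖x‖ ^ 2 + 8 * ‖a + b‖ ^ 2) ≤ 2 * (inner ℝ x a + inner ℝ x b) := by
      have h1 := neg_le_of_abs_le (abs_real_inner_le_norm x (a + b))
      rw [inner_add_right] at h1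
      nlinarith [sq_nonneg (‖x‖ - 50 / 7 * ‖a + b‖), sq_nonneg ‖a + b‖]
    have hin' := mul_le_mul_of_nonneg_left hin (w0 t)
    have hM' := mul_le_mul_of_nonneg_right (wM t ht) (sq_nonneg ‖a + b‖)
    have hdd : d t * ‖x‖ ^ 2 ≤ T * ‖x‖ ^ 2 :=
      mul_le_mul_of_nonneg_right (by linarith [dT t]) (sq_nonneg _)
    have p1 : 0 ≤ w t * ‖ut (t, θ)‖ ^ 2 := mul_nonneg (w0 t) (sq_nonneg _)
    have p2 : 0 ≤ w t * ‖uθ (t, θ)‖ ^ 2 := mul_nonneg (w0 t) (sq_nonneg _)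
    have p3 : 0 ≤ w t * ‖x‖ ^ 2 := mul_nonneg (w0 t) (sq_nonneg _)
    have p4 : 0 ≤ (1 + 6 / 5 * T) * (‖ut (t, θ)‖ ^ 2 + ‖uθ (t, θ)‖ ^ 2) := by positivity
    linarith
  rw [cylInt_add (by fun_prop) (by fun_prop), cylInt_add (by fun_prop) (by fun_prop),
    cylInt_add (by fun_prop) (by fun_prop), cylInt_add (by fun_prop) (by fun_prop),
    cylInt_add (by fun_prop) (by fun_prop), cylInt_const_mul, cylInt_const_mul, cylInt_const_mul,
    cylInt_const_mul, cylInt_const_mul, s2] at s4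
  simp only [hd, hw] at *
  linarith

theorem exp_growth_dominates {L : ℝ} (hL : 100000 ≤ L) :
    36 / 25 * (1 + 18 / 5 * L) * (exp L + 2) +
      43 / 25 * (3 * (exp (9 / 5 * L) * (3 * (1 + 9 * L ^ 2) * exp (-L)))) + 1 <
      7 / 50 * (exp (6 / 5 * L) - 1 - 6 / 5 * L) := by
  have hy : L + 1 ≤ exp L := add_one_le_exp L
  set y := exp L with hy'
  have e1 : exp (9 / 5 * L) * exp (-L) ≤ y := by
    rw [← exp_add]; exact exp_le_exp.2 (by linarith)
  have e2 : y * (L / 20) ^ 4 ≤ exp (6 / 5 * L) := by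
    have h1 : exp (6 / 5 * L) = y * exp (L / 20) ^ 4 := by
      rw [hy', ← exp_nat_mul, ← exp_add]; congr 1; push_cast; ring
    rw [h1]
    refine mul_le_mul_of_nonneg_left (pow_le_pow_left₀ (by positivity) ?_ 4) (by positivity)
    linarith [add_one_le_exp (L / 20)]
  have e3 : 43 / 25 * (3 * (exp (9 / 5 * L) * (3 * (1 + 9 * L ^ 2) * exp (-L)))) ≤
      43 / 25 * 9 * (1 + 9 * L ^ 2) * y := by
    have := mul_le_mul_of_nonneg_left e1 (show 0 ≤ 43 / 25 * 9 * (1 + 9 * L ^ 2) by positivity)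
    linarith
  have e4 : 36 / 25 * (1 + 18 / 5 * L) * (y + 2) ≤ 36 / 25 * (1 + 18 / 5 * L) * (3 * y) :=
    mul_le_mul_of_nonneg_left (by linarith) (by positivity)
  have hL2 : 10 ^ 5 * L ≤ L ^ 2 := by nlinarith
  have hL4 : 10 ^ 10 * L ^ 2 ≤ L ^ 4 := by nlinarith
  have e5 : 0 < y * (7 / 50 * (L / 20) ^ 4 - 7 / 25 - 43 / 25 * 9 * (1 + 9 * L ^ 2)
      - 36 / 25 * (1 + 18 / 5 * L) * 3 - 1) := by
    refine mul_pos (exp_pos L) ?_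
    nlinarith
  nlinarith

theorem IsStripJet.cylInt_middle_nonpos {k : ℕ} {L : ℝ}
    {u ut uθ utt uθθ : ℝ × ℝ → EuclideanSpace ℝ (Fin k)}
    (J : IsStripJet (3 * L) u ut uθ utt uθθ) (hL : 100000 ≤ L) {a : ℝ} (ha0 : 0 ≤ a)
    (haL : a ≤ 2 * L)
    (hsmall : cylInt a (a + L) (energyDensity u ut uθ) ≤
      exp (-L) * cylInt L (2 * L) (energyDensity u ut uθ))
    (htotal : cylInt 0 (3 * L) (energyDensity u ut uθ) ≤
      (exp L + 2) * cylInt L (2 * L) (energyDensity u ut uθ))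
    (hF : 1000 * L ^ 4 * exp (9 / 5 * L) * cylInt 0 (3 * L) (fun p => ‖utt p + uθθ p‖ ^ 2) ≤
      cylInt L (2 * L) (energyDensity u ut uθ)) :
    cylInt L (2 * L) (energyDensity u ut uθ) ≤ 0 := by
  have c2 := J.cont_tt
  have c3 := J.cont_θθ
  have ce := J.continuous_energyDensity
  have e0 : ∀ p, 0 ≤ energyDensity u ut uθ p := fun p => by unfold energyDensity; positivity
  set N := cylInt L (2 * L) (energyDensity u ut uθ) with hN
  set F := cylInt 0 (3 * L) (fun p => ‖utt p + uθθ p‖ ^ 2) with hF'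
  set S := cylInt a (a + L) (energyDensity u ut uθ) with hS
  have hL0 : 0 < L := by linarith
  have S0 : 0 ≤ S := cylInt_nonneg (by linarith) e0
  have F0 : 0 ≤ F := cylInt_nonneg (by linarith) fun p => by positivity
  have N0 : 0 ≤ N := cylInt_nonneg (by linarith) e0
  set ζ := (3 * (1 + 9 * L ^ 2) * S + 81 * L ^ 4 * F) / L with hζ
  have hζ0 : 0 ≤ ζ := by positivity
  have hζb : ∀ t ∈ Set.Ioo 0 (3 * L),
      (2 * π)⁻¹ * ‖∫ θ in (0 : ℝ)..(2 * π), u (t, θ)‖ ^ 2 ≤ ζ := by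
    intro t ht
    rw [hζ, le_div_iff₀ hL0]
    have hcirc := continuous_circleInt ce
    have hint : ∫ _ in a..(a + L), (2 * π)⁻¹ * ‖∫ θ in (0 : ℝ)..(2 * π), u (t, θ)‖ ^ 2 ≤
        ∫ r in a..(a + L), (3 * (1 + (3 * L) ^ 2) *
          (∫ θ in (0 : ℝ)..(2 * π), energyDensity u ut uθ (r, θ)) + 3 * (3 * L) ^ 3 * F) :=
      intervalIntegral.integral_mono_on (by linarith) (by simp)
        (Continuous.intervalIntegrable (by fun_prop) _ _) fun r hr =>
          J.sq_norm_circleInt_le ⟨ht.1.le, ht.2.le⟩ ⟨by linarith [hr.1], by linarith [hr.2]⟩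
    rw [intervalIntegral.integral_add (Continuous.intervalIntegrable (by fun_prop) _ _)
      (by simp), intervalIntegral.integral_const_mul (3 * (1 + (3 * L) ^ 2)),
      intervalIntegral.integral_const, intervalIntegral.integral_const] at hint
    simp only [smul_eq_mul, add_sub_cancel_left] at hint
    change _ ≤ 3 * (1 + (3 * L) ^ 2) * S + _ at hint
    linarith
  have main := J.cylInt_expRem_energy_le (by linarith) hζ0 hζb
  have mono_expRem : ∀ d : ℝ, L ≤ d →
      exp (6 / 5 * L) - 1 - 6 / 5 * L ≤ exp (6 / 5 * d) - 1 - 6 / 5 * d := by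
    intro d hd
    have h1 := add_one_le_exp (6 / 5 * (d - L))
    have h2 : exp (6 / 5 * d) = exp (6 / 5 * L) * exp (6 / 5 * (d - L)) := by
      rw [← exp_add]; congr 1; ring
    have h3 := one_le_exp (show 0 ≤ 6 / 5 * L by positivity)
    rw [h2]
    nlinarith
  have lower : (exp (6 / 5 * L) - 1 - 6 / 5 * L) * N ≤ cylInt 0 (3 * L) (fun p =>
      (exp (6 / 5 * min p.1 (3 * L - p.1)) - 1 - 6 / 5 * min p.1 (3 * L - p.1)) *
        energyDensity u ut uθ p) := by
    set W : ℝ × ℝ → ℝ := fun p => (exp (6 / 5 * min p.1 (3 * L - p.1)) - 1 -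
      6 / 5 * min p.1 (3 * L - p.1)) * energyDensity u ut uθ p with hW
    have cW : Continuous W := by fun_prop
    have W0 : ∀ p, 0 ≤ W p := fun p =>
      mul_nonneg (by linarith [add_one_le_exp (6 / 5 * min p.1 (3 * L - p.1))]) (e0 p)
    rw [← cylInt_add_adjacent cW 0 L (3 * L), ← cylInt_add_adjacent cW L (2 * L) (3 * L),
      hN, ← cylInt_const_mul]
    have h1 : 0 ≤ cylInt 0 L W := cylInt_nonneg hL0.le W0
    have h2 : 0 ≤ cylInt (2 * L) (3 * L) W := cylInt_nonneg (by linarith) W0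
    have h3 : cylInt L (2 * L) (fun p => (exp (6 / 5 * L) - 1 - 6 / 5 * L) *
        energyDensity u ut uθ p) ≤ cylInt L (2 * L) W :=
      cylInt_mono (by fun_prop) cW (by linarith) fun t ht θ =>
        mul_le_mul_of_nonneg_right
          (mono_expRem _ (le_min ht.1.le (by linarith [ht.2]))) (e0 _)
    linarith
  have hexp : exp (6 / 5 * (3 * L / 2)) = exp (9 / 5 * L) := by congr 1; ring
  have hTζ : 3 * L * (exp (6 / 5 * (3 * L / 2)) * ζ) =
      3 * (exp (9 / 5 * L) * (3 * (1 + 9 * L ^ 2) * S)) +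
        243 * (L ^ 4 * exp (9 / 5 * L) * F) := by
    rw [hexp, hζ]; field_simp; ring
  rw [hTζ, hexp] at main
  have hS' : 3 * (exp (9 / 5 * L) * (3 * (1 + 9 * L ^ 2) * S)) ≤
      3 * (exp (9 / 5 * L) * (3 * (1 + 9 * L ^ 2) * (exp (-L) * N))) := by gcongr
  have ht' : 36 / 25 * (1 + 6 / 5 * (3 * L)) * cylInt 0 (3 * L) (energyDensity u ut uθ) ≤
      36 / 25 * (1 + 6 / 5 * (3 * L)) * ((exp L + 2) * N) := by gcongr
  have hF8 : exp (9 / 5 * L) * F ≤ L ^ 4 * exp (9 / 5 * L) * F := by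
    have : 1 ≤ L ^ 4 := one_le_pow₀ (by linarith)
    rw [mul_assoc]
    exact le_mul_of_one_le_left (by positivity) this
  have hdom := exp_growth_dominates hL
  by_contra! hpos
  have hdomN := mul_lt_mul_of_pos_right hdom hpos
  nlinarith

/-- Projection of the plane onto the closed strip `[0, T] × ℝ`. -/
def stripProj (T : ℝ) (p : ℝ × ℝ) : ℝ × ℝ := (max 0 (min T p.1), p.2)

theorem stripProj_eq {T t : ℝ} (ht : t ∈ Set.Icc 0 T) (θ : ℝ) : stripProj T (t, θ) = (t, θ) := by
  simp [stripProj, ht.1, ht.2]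

theorem continuous_comp_stripProj {V : Type*} [TopologicalSpace V] {T : ℝ} (hT : 0 ≤ T)
    {g : ℝ × ℝ → V} (hg : ContinuousOn g (Set.Icc 0 T ×ˢ Set.univ)) :
    Continuous fun p => g (stripProj T p) :=
  hg.comp_continuous (by unfold stripProj; fun_prop) fun p =>
    ⟨⟨le_max_left _ _, max_le hT (min_le_left _ _)⟩, trivial⟩

theorem strip_mem_nhds {T t : ℝ} (ht : t ∈ Set.Ioo 0 T) (θ : ℝ) :
    (Set.Icc 0 T ×ˢ (Set.univ : Set ℝ)) ∈ nhds (t, θ) :=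
  prod_mem_nhds (Icc_mem_nhds ht.1 ht.2) Filter.univ_mem

section

variable {V : Type*} [NormedAddCommGroup V] [NormedSpace ℝ V] {T t : ℝ} {g : ℝ × ℝ → V}

theorem hasFDerivAt_fderivWithin_strip
    (hg : ContDiffOn ℝ 1 g (Set.Icc 0 T ×ˢ Set.univ)) (ht : t ∈ Set.Ioo 0 T) (θ : ℝ) :
    HasFDerivAt g (fderivWithin ℝ g (Set.Icc 0 T ×ˢ Set.univ) (t, θ)) (t, θ) := by
  have hn := strip_mem_nhds ht θ
  rw [fderivWithin_of_mem_nhds hn]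
  exact ((hg.contDiffAt hn).differentiableAt (by norm_num)).hasFDerivAt

theorem hasDerivAt_comp_stripProj_fst
    (hg : ContDiffOn ℝ 1 g (Set.Icc 0 T ×ˢ Set.univ)) (ht : t ∈ Set.Ioo 0 T) (θ : ℝ) :
    HasDerivAt (fun s => g (stripProj T (s, θ)))
      (fderivWithin ℝ g (Set.Icc 0 T ×ˢ Set.univ) (stripProj T (t, θ)) (1, 0)) t := by
  rw [stripProj_eq (Set.Ioo_subset_Icc_self ht)]
  have hc : HasDerivAt (fun s : ℝ => (s, θ)) ((1 : ℝ), (0 : ℝ)) t :=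
    (hasDerivAt_id t).prodMk (hasDerivAt_const t θ)
  refine ((hasFDerivAt_fderivWithin_strip hg ht θ).comp_hasDerivAt t hc).congr_of_eventuallyEq ?_
  filter_upwards [Icc_mem_nhds ht.1 ht.2] with s hs
  simp [stripProj_eq hs]

theorem hasDerivAt_comp_stripProj_snd
    (hg : ContDiffOn ℝ 1 g (Set.Icc 0 T ×ˢ Set.univ)) (ht : t ∈ Set.Ioo 0 T) (θ : ℝ) :
    HasDerivAt (fun x => g (stripProj T (t, x)))
      (fderivWithin ℝ g (Set.Icc 0 T ×ˢ Set.univ) (stripProj T (t, θ)) (0, 1)) θ := by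
  simp only [stripProj_eq (Set.Ioo_subset_Icc_self ht)]
  have hc : HasDerivAt (fun x : ℝ => (t, x)) ((0 : ℝ), (1 : ℝ)) θ :=
    (hasDerivAt_const θ t).prodMk (hasDerivAt_id θ)
  exact (hasFDerivAt_fderivWithin_strip hg ht θ).comp_hasDerivAt θ hc

theorem exists_isStripJet (hT : 0 < T)
    (hg : ContDiffOn ℝ 2 g (Set.Icc 0 T ×ˢ Set.univ)) (hper : ∀ t θ, g (t, θ + 2 * π) = g (t, θ)) :
    ∃ u ut uθ utt uθθ : ℝ × ℝ → V, IsStripJet T u ut uθ utt uθθ ∧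
      ∀ t ∈ Set.Ioo 0 T, ∀ θ, u (t, θ) = g (t, θ) ∧ ut (t, θ) = pt g (t, θ) ∧
        uθ (t, θ) = pθ g (t, θ) ∧ utt (t, θ) + uθθ (t, θ) = cylLap g (t, θ) := by
  set S : Set (ℝ × ℝ) := Set.Icc 0 T ×ˢ Set.univ with hS
  have hSd : UniqueDiffOn ℝ S := (uniqueDiffOn_Icc hT).prod uniqueDiffOn_univ
  have hg1 : ContDiffOn ℝ 1 g S := hg.of_le (by norm_num)
  have hD : ContDiffOn ℝ 1 (fderivWithin ℝ g S) S := hg.fderivWithin hSd (by norm_num)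
  have hDv : ∀ v, ContDiffOn ℝ 1 (fun p => fderivWithin ℝ g S p v) S := fun v =>
    hD.clm_apply contDiffOn_const
  have hDDc : ∀ v, ContinuousOn
      (fun p => fderivWithin ℝ (fun q => fderivWithin ℝ g S q v) S p v) S := fun v =>
    ((hDv v).continuousOn_fderivWithin hSd (by norm_num)).clm_apply continuousOn_const
  have hfd : ∀ v, ∀ t ∈ Set.Ioo 0 T, ∀ θ,
      fderivWithin ℝ g S (t, θ) v = fderiv ℝ g (t, θ) v := fun v t ht θ => by
    rw [fderivWithin_of_mem_nhds (strip_mem_nhds ht θ)]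
  have hfdd : ∀ v, ∀ t ∈ Set.Ioo 0 T, ∀ θ,
      fderivWithin ℝ (fun q => fderivWithin ℝ g S q v) S (t, θ) v =
        fderiv ℝ (fun q => fderiv ℝ g q v) (t, θ) v := fun v t ht θ => by
    rw [fderivWithin_of_mem_nhds (strip_mem_nhds ht θ)]
    refine congrArg (fun D : ℝ × ℝ →L[ℝ] V => D v) (Filter.EventuallyEq.fderiv_eq ?_)
    filter_upwards [prod_mem_nhds (Ioo_mem_nhds ht.1 ht.2) Filter.univ_mem] with q hq
    exact hfd v q.1 hq.1 q.2
  have hperu : ∀ t ∈ Set.Ioo 0 T, ∀ θ, g (stripProj T (t, θ + 2 * π)) = g (stripProj T (t, θ)) :=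
    fun t ht θ => by
      rw [stripProj_eq (Set.Ioo_subset_Icc_self ht), stripProj_eq (Set.Ioo_subset_Icc_self ht),
        hper]
  refine ⟨fun p => g (stripProj T p), fun p => fderivWithin ℝ g S (stripProj T p) (1, 0),
    fun p => fderivWithin ℝ g S (stripProj T p) (0, 1),
    fun p => fderivWithin ℝ (fun q => fderivWithin ℝ g S q (1, 0)) S (stripProj T p) (1, 0),
    fun p => fderivWithin ℝ (fun q => fderivWithin ℝ g S q (0, 1)) S (stripProj T p) (0, 1),
    ⟨continuous_comp_stripProj hT.le hg.continuousOn,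
      continuous_comp_stripProj hT.le (hDv _).continuousOn,
      continuous_comp_stripProj hT.le (hDv _).continuousOn,
      continuous_comp_stripProj hT.le (hDDc _),
      continuous_comp_stripProj hT.le (hDDc _),
      fun t ht θ => hasDerivAt_comp_stripProj_fst hg1 ht θ,
      fun t ht θ => hasDerivAt_comp_stripProj_fst (hDv _) ht θ,
      fun t ht θ => hasDerivAt_comp_stripProj_snd hg1 ht θ,
      fun t ht θ => hasDerivAt_comp_stripProj_snd (hDv _) ht θ,
      fun t ht => by simpa using hperu t ht 0, fun t ht => ?_⟩, fun t ht θ => ?_⟩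
  · have h1 := hasDerivAt_comp_stripProj_snd hg1 ht (0 + 2 * π)
    have h2 := h1.comp_add_const 0 (2 * π)
    simp only [hperu t ht] at h2
    rw [zero_add] at h2
    exact h2.unique (hasDerivAt_comp_stripProj_snd hg1 ht 0)
  · simp only [stripProj_eq (Set.Ioo_subset_Icc_self ht)]
    refine ⟨trivial, hfd _ t ht θ, hfd _ t ht θ, ?_⟩
    rw [hfdd _ t ht θ, hfdd _ t ht θ]
    rfl

end

theorem sq_norm_sub_three_le {V : Type*} [SeminormedAddCommGroup V] (x y z w : V) :
    ‖x - y - z - w‖ ^ 2 ≤ 4 * (‖x‖ ^ 2 + ‖y‖ ^ 2 + ‖z‖ ^ 2 + ‖w‖ ^ 2) := by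
  have h : ‖x - y - z - w‖ ≤ ‖x‖ + ‖y‖ + ‖z‖ + ‖w‖ :=
    (norm_sub_le _ _).trans (by linarith [norm_sub_le (x - y) z, norm_sub_le x y])
  have := pow_le_pow_left₀ (norm_nonneg _) h 2
  linarith [sq_nonneg (‖x‖ - ‖y‖), sq_nonneg (‖x‖ - ‖z‖), sq_nonneg (‖x‖ - ‖w‖),
    sq_nonneg (‖y‖ - ‖z‖), sq_nonneg (‖y‖ - ‖w‖), sq_nonneg (‖z‖ - ‖w‖)]

theorem sq_normOne {V : Type*} [NormedAddCommGroup V] [NormedSpace ℝ V] {L : ℝ} (hL : 0 ≤ L)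
    (i : ℕ) (u : ℝ × ℝ → V) : normOne L i u ^ 2 = normOneSq L i u :=
  sq_sqrt <| intervalIntegral.integral_nonneg (by nlinarith) fun _ _ =>
    intervalIntegral.integral_nonneg (by positivity) fun _ _ => by positivity

/-- The radius of smallness of the perturbation on cylinder pieces of length `L`. -/
noncomputable def perturbationRadius (L : ℝ) : ℝ :=
  √(8000 * (exp L + 1) * (L ^ 4 * exp (9 / 5 * L)))⁻¹

theorem normOne_two_nonpos {k : ℕ} {L : ℝ} (hL : 100000 ≤ L)
    {u h : ℝ × ℝ → EuclideanSpace ℝ (Fin k)}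
    {At Aθ B : ℝ × ℝ → (EuclideanSpace ℝ (Fin k) →L[ℝ] EuclideanSpace ℝ (Fin k))}
    (hu : ContDiffOn ℝ 2 u ((Set.Icc (0 : ℝ) (3 * L)) ×ˢ (Set.univ : Set ℝ)))
    (hper : ∀ t θ : ℝ, u (t, θ + 2 * π) = u (t, θ)) (ch : Continuous h)
    (hAt : ∀ p ∈ (Set.Icc (0 : ℝ) (3 * L)) ×ˢ (Set.univ : Set ℝ), ‖At p‖ ≤ perturbationRadius L)
    (hAθ : ∀ p ∈ (Set.Icc (0 : ℝ) (3 * L)) ×ˢ (Set.univ : Set ℝ), ‖Aθ p‖ ≤ perturbationRadius L)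
    (hB : ∀ p ∈ (Set.Icc (0 : ℝ) (3 * L)) ×ˢ (Set.univ : Set ℝ), ‖B p‖ ≤ perturbationRadius L)
    (heq : ∀ p ∈ (Set.Icc (0 : ℝ) (3 * L)) ×ˢ (Set.univ : Set ℝ),
      cylLap u p + At p (pt u p) + Aθ p (pθ u p) + B p (u p) = h p)
    (hh : √(∫ t in (0 : ℝ)..(3 * L), ∫ θ in (0 : ℝ)..(2 * π), ‖h (t, θ)‖ ^ 2) ≤
      perturbationRadius L * max (normOne L 1 u) (max (normOne L 2 u) (normOne L 3 u)))
    (h1 : exp (-(L / 2)) * normOne L 1 u ≤ normOne L 2 u)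
    (h3 : exp (-(L / 2)) * normOne L 3 u ≤ normOne L 2 u)
    (hsmall : normOne L 1 u ≤ exp (-(L / 2)) * normOne L 2 u ∨
      normOne L 3 u ≤ exp (-(L / 2)) * normOne L 2 u) :
    normOne L 2 u ≤ 0 := by
  have hL0 : 0 < L := by linarith
  obtain ⟨v, vt, vθ, vtt, vθθ, J, hJ⟩ := exists_isStripJet (show 0 < 3 * L by linarith) hu hper
  have ce := J.continuous_energyDensity
  have ctt := J.cont_tt
  have cθθ := J.cont_θθ
  set e := energyDensity v vt vθ with he
  have hN : ∀ i : ℕ, 1 ≤ i → i ≤ 3 →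
      normOne L i u ^ 2 = cylInt (((i : ℝ) - 1) * L) ((i : ℝ) * L) e := by
    intro i hi1 hi3
    have hi1' : (1 : ℝ) ≤ i := by exact_mod_cast hi1
    have hi3' : (i : ℝ) ≤ 3 := by exact_mod_cast hi3
    rw [sq_normOne hL0.le]
    refine cylInt_congr (F := fun p => ‖u p‖ ^ 2 + ‖pt u p‖ ^ 2 + ‖pθ u p‖ ^ 2) (by nlinarith)
      fun t ht θ => ?_
    obtain ⟨e1, e2, e3, -⟩ := hJ t ⟨by nlinarith [ht.1], by nlinarith [ht.2]⟩ θ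
    simp only [he, energyDensity, e1, e2, e3]
  have N1 := hN 1 (by norm_num) (by norm_num)
  have N2 := hN 2 (by norm_num) (by norm_num)
  have N3 := hN 3 (by norm_num) (by norm_num)
  norm_num at N1 N2 N3
  set n1 := normOne L 1 u with hn1
  set n2 := normOne L 2 u with hn2
  set n3 := normOne L 3 u with hn3
  have n10 : 0 ≤ n1 := sqrt_nonneg _
  have n20 : 0 ≤ n2 := sqrt_nonneg _
  have n30 : 0 ≤ n3 := sqrt_nonneg _
  set q := exp (-(L / 2)) with hq
  have hq0 : 0 < q := exp_pos _
  have hq1 : q ≤ 1 := exp_le_one_iff.2 (by linarith)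
  have hqq : q ^ 2 = exp (-L) := by rw [hq, ← exp_nat_mul]; congr 1; push_cast; ring
  have hqe : exp L * q ^ 2 = 1 := by rw [hqq, ← exp_add, add_neg_cancel, exp_zero]
  have hy : 0 < exp L := exp_pos L
  have sq_big : ∀ x, 0 ≤ x → q * x ≤ n2 → x ^ 2 ≤ exp L * n2 ^ 2 := by
    intro x hx hxn
    have := mul_le_mul_of_nonneg_left (pow_le_pow_left₀ (by positivity) hxn 2) hy.le
    rw [mul_pow, ← mul_assoc, hqe, one_mul] at this
    exact this
  have sq_small : ∀ x, 0 ≤ x → x ≤ q * n2 → x ^ 2 ≤ exp (-L) * n2 ^ 2 := by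
    intro x hx hxn
    have := pow_le_pow_left₀ hx hxn 2
    rwa [mul_pow, hqq] at this
  have hsmall1 : exp (-L) * n2 ^ 2 ≤ n2 ^ 2 :=
    mul_le_of_le_one_left (sq_nonneg _) (exp_le_one_iff.2 (by linarith))
  have h13 : n1 ^ 2 + n3 ^ 2 ≤ (exp L + 1) * n2 ^ 2 := by
    rcases hsmall with hs | hs
    · linarith [sq_small n1 n10 hs, sq_big n3 n30 h3]
    · linarith [sq_small n3 n30 hs, sq_big n1 n10 h1]
  have htot : cylInt 0 (3 * L) e = n1 ^ 2 + n2 ^ 2 + n3 ^ 2 := by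
    rw [N1, N2, N3, cylInt_add_adjacent ce, cylInt_add_adjacent ce]
  set δ := perturbationRadius L with hδ
  have hδ0 : 0 ≤ δ := sqrt_nonneg _
  have hδ2 : δ ^ 2 * (8000 * (exp L + 1) * (L ^ 4 * exp (9 / 5 * L))) = 1 := by
    rw [hδ, perturbationRadius, sq_sqrt (by positivity), inv_mul_cancel₀ (by positivity)]
  have hH : cylInt 0 (3 * L) (fun p => ‖h p‖ ^ 2) ≤ δ ^ 2 * (exp L * n2 ^ 2) := by
    set m := max n1 (max n2 n3) with hm
    have hm2 : m ^ 2 ≤ exp L * n2 ^ 2 := by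
      refine sq_big m (n10.trans (le_max_left _ _)) ?_
      rw [hm, mul_max_of_nonneg _ _ hq0.le, mul_max_of_nonneg _ _ hq0.le]
      exact max_le h1 (max_le (mul_le_of_le_one_left n20 hq1) h3)
    have h0 : 0 ≤ cylInt 0 (3 * L) (fun p => ‖h p‖ ^ 2) :=
      cylInt_nonneg (by linarith) fun p => by positivity
    have := pow_le_pow_left₀ (sqrt_nonneg _) hh 2
    rw [mul_pow] at this
    change √(cylInt 0 (3 * L) (fun p => ‖h p‖ ^ 2)) ^ 2 ≤ _ at this
    rw [sq_sqrt h0] at this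
    exact this.trans (mul_le_mul_of_nonneg_left hm2 (sq_nonneg _))
  have hF : cylInt 0 (3 * L) (fun p => ‖vtt p + vθθ p‖ ^ 2) ≤
      4 * cylInt 0 (3 * L) (fun p => ‖h p‖ ^ 2) + 4 * δ ^ 2 * cylInt 0 (3 * L) e := by
    rw [← cylInt_const_mul, ← cylInt_const_mul, ← cylInt_add (by fun_prop) (by fun_prop)]
    refine cylInt_mono (by fun_prop) (by fun_prop) (by linarith) fun t ht θ => ?_
    have hp : (t, θ) ∈ (Set.Icc (0 : ℝ) (3 * L)) ×ˢ (Set.univ : Set ℝ) :=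
      ⟨Set.Ioo_subset_Icc_self ht, trivial⟩
    obtain ⟨e1, e2, e3, e4⟩ := hJ t ht θ
    have heqp : vtt (t, θ) + vθθ (t, θ) = h (t, θ) - At (t, θ) (vt (t, θ)) -
        Aθ (t, θ) (vθ (t, θ)) - B (t, θ) (v (t, θ)) := by
      rw [e4, e1, e2, e3, ← heq _ hp]
      abel
    have hop : ∀ A : EuclideanSpace ℝ (Fin k) →L[ℝ] EuclideanSpace ℝ (Fin k), ‖A‖ ≤ δ →
        ∀ x, ‖A x‖ ^ 2 ≤ δ ^ 2 * ‖x‖ ^ 2 := fun A hA x => by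
      rw [← mul_pow]
      exact pow_le_pow_left₀ (norm_nonneg _) (A.le_of_opNorm_le hA x) 2
    rw [heqp]
    refine (sq_norm_sub_three_le _ _ _ _).trans ?_
    have b1 := hop _ (hAt _ hp) (vt (t, θ))
    have b2 := hop _ (hAθ _ hp) (vθ (t, θ))
    have b3 := hop _ (hB _ hp) (v (t, θ))
    simp only [he, energyDensity]
    linarith
  have hFs : 1000 * L ^ 4 * exp (9 / 5 * L) *
      cylInt 0 (3 * L) (fun p => ‖vtt p + vθθ p‖ ^ 2) ≤ n2 ^ 2 := by
    have hF2 : cylInt 0 (3 * L) (fun p => ‖vtt p + vθθ p‖ ^ 2) ≤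
        δ ^ 2 * (8 * (exp L + 1)) * n2 ^ 2 := by
      have := mul_le_mul_of_nonneg_left h13 (sq_nonneg δ)
      rw [htot] at hF
      linarith
    refine (mul_le_mul_of_nonneg_left hF2 (by positivity)).trans (le_of_eq ?_)
    linear_combination n2 ^ 2 * hδ2
  have htot' : cylInt 0 (3 * L) e ≤ (exp L + 2) * n2 ^ 2 := by rw [htot]; linarith
  rw [N2] at hFs htot'
  have hmid : cylInt L (2 * L) e ≤ 0 := by
    rcases hsmall with hs | hs
    · have := sq_small n1 n10 hs
      rw [N1, N2] at this
      exact J.cylInt_middle_nonpos hL (a := 0) le_rfl (by linarith) (by rwa [zero_add]) htot' hFs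
    · have := sq_small n3 n30 hs
      rw [N3, N2] at this
      exact J.cylInt_middle_nonpos hL (a := 2 * L) (by linarith) le_rfl
        (by rwa [show 2 * L + L = 3 * L by ring]) htot' hFs
  rw [← N2] at hmid
  nlinarith

/-- There exists `L₁ > 0` such that for every `L ≥ L₁` there is `δ₀ > 0` with: any `2π`-periodic
`C²` solution `u` of `Δu + A_t ∂_t u + A_θ ∂_θ u + B u = h` on `[0,3L] × ℝ`, with coefficients
bounded by `δ₀` and `‖h‖_{L²} ≤ δ₀ · maxᵢ ‖u‖₁,ᵢ`, satisfies:
(a) `‖u‖₁,₃ ≤ e^{-L/2} ‖u‖₁,₂` implies `‖u‖₁,₂ ≤ e^{-L/2} ‖u‖₁,₁`, and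
(b) `‖u‖₁,₁ ≤ e^{-L/2} ‖u‖₁,₂` implies `‖u‖₁,₂ ≤ e^{-L/2} ‖u‖₁,₃`. -/
theorem perturbed_harmonic_three_annuli :
    ∃ L₁ : ℝ, 0 < L₁ ∧ ∀ L : ℝ, L₁ ≤ L → ∃ δ₀ : ℝ, 0 < δ₀ ∧
      ∀ (k : ℕ) (u h : ℝ × ℝ → EuclideanSpace ℝ (Fin k))
        (At Aθ B : ℝ × ℝ → (EuclideanSpace ℝ (Fin k) →L[ℝ] EuclideanSpace ℝ (Fin k))),
        ContDiffOn ℝ 2 u ((Set.Icc (0 : ℝ) (3 * L)) ×ˢ (Set.univ : Set ℝ)) →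
        (∀ t θ : ℝ, u (t, θ + 2 * π) = u (t, θ)) →
        Continuous At → Continuous Aθ → Continuous B → Continuous h →
        (∀ p ∈ (Set.Icc (0 : ℝ) (3 * L)) ×ˢ (Set.univ : Set ℝ), ‖At p‖ ≤ δ₀) →
        (∀ p ∈ (Set.Icc (0 : ℝ) (3 * L)) ×ˢ (Set.univ : Set ℝ), ‖Aθ p‖ ≤ δ₀) →
        (∀ p ∈ (Set.Icc (0 : ℝ) (3 * L)) ×ˢ (Set.univ : Set ℝ), ‖B p‖ ≤ δ₀) →
        (∀ p ∈ (Set.Icc (0 : ℝ) (3 * L)) ×ˢ (Set.univ : Set ℝ),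
          cylLap u p + At p (pt u p) + Aθ p (pθ u p) + B p (u p) = h p) →
        Real.sqrt (∫ t in (0 : ℝ)..(3 * L), ∫ θ in (0 : ℝ)..(2 * π), ‖h (t, θ)‖ ^ 2) ≤
          δ₀ * max (normOne L 1 u) (max (normOne L 2 u) (normOne L 3 u)) →
        ((normOne L 3 u ≤ Real.exp (-(L / 2)) * normOne L 2 u →
            normOne L 2 u ≤ Real.exp (-(L / 2)) * normOne L 1 u) ∧
         (normOne L 1 u ≤ Real.exp (-(L / 2)) * normOne L 2 u →
            normOne L 2 u ≤ Real.exp (-(L / 2)) * normOne L 3 u)) := by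
  refine ⟨100000, by norm_num, fun L hL => ⟨perturbationRadius L, ?_, ?_⟩⟩
  · have : 0 < L := by linarith
    unfold perturbationRadius
    positivity
  · intro k u h At Aθ B hu hper _ _ _ ch hAt hAθ hB heq hh
    have hq : exp (-(L / 2)) ≤ 1 := exp_le_one_iff.2 (by linarith)
    have shrink : ∀ {x y : ℝ}, 0 ≤ x → y ≤ exp (-(L / 2)) * x → exp (-(L / 2)) * y ≤ x :=
      fun {x y} hx hy => by
        have h1 : exp (-(L / 2)) * x ≤ x := mul_le_of_le_one_left hx hq
        have h2 := mul_le_mul_of_nonneg_left (hy.trans h1) (exp_pos (-(L / 2))).le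
        exact h2.trans h1
    have hn : ∀ i, 0 ≤ normOne L i u := fun i => sqrt_nonneg _
    constructor
    · intro hs
      by_contra! hlt
      have := normOne_two_nonpos hL hu hper ch hAt hAθ hB heq hh hlt.le (shrink (hn 2) hs)
        (Or.inr hs)
      have := mul_nonneg (exp_pos (-(L / 2))).le (hn 1)
      linarith
    · intro hs
      by_contra! hlt
      have := normOne_two_nonpos hL hu hper ch hAt hAθ hB heq hh (shrink (hn 2) hs) hlt.le
        (Or.inl hs)
      have := mul_nonneg (exp_pos (-(L / 2))).le (hn 3)
      linarith
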